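/- arXiv:1007.0583 — 4 statements merged into one kernel-verified Lean document; each statement's English description precedes it below -/
import Mathlib

section
/- Let Σ ⊆ CAT(Λ_s^ℕ) be an ID semigroup. Then the semigroup ⟨Σ, σ^{−1}⟩ ⊆ CAT(Λ_s^ℤ) generated by Σ (regarded inside CAT(Λ_s^ℤ)) together with the inverse shift σ^{−1} is an ID semigroup acting on Λ_s^ℤ. -/
/-- The left shift on one-sided sequences over the alphabet `A`. -/
def shiftN (A : Type) : (ℕ → A) → (ℕ → A) := fun a k => a (k + 1)

/-- A cellular automaton transformation of the one-sided full shift over `A`. -/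
def IsCAT (A : Type) [TopologicalSpace A] (τ : (ℕ → A) → (ℕ → A)) : Prop :=
  Continuous τ ∧ τ ∘ shiftN A = shiftN A ∘ τ

/-- The semigroup `CAT(Λ^ℕ)` of all one-sided cellular automaton transformations. -/
def CATset (A : Type) [TopologicalSpace A] : Set ((ℕ → A) → (ℕ → A)) := {τ | IsCAT A τ}

/-- The left shift on two-sided sequences over the alphabet `A`. -/
def shiftZ (A : Type) : (ℤ → A) → (ℤ → A) := fun a k => a (k + 1)

/-- The inverse shift `σ⁻¹` on two-sided sequences. -/
def invShiftZ (A : Type) : (ℤ → A) → (ℤ → A) := fun a k => a (k - 1)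

/-- The canonical extension of a one-sided cellular automaton transformation to the
two-sided shift space: it applies the same block map at every coordinate, namely
`(extendZ τ a)_k = τ(a_k a_{k+1} a_{k+2} …)_0`. This realizes the inclusion
`CAT(Λ^ℕ) ⊆ CAT(Λ^ℤ)`. -/
def extendZ (A : Type) (τ : (ℕ → A) → (ℕ → A)) : (ℤ → A) → (ℤ → A) :=
  fun a k => τ (fun n => a (k + n)) 0

/-- Membership in the semigroup generated (under composition) by a set of transformations. -/
inductive InGen {Ω : Type} (S : Set (Ω → Ω)) : (Ω → Ω) → Prop
  | base {τ : Ω → Ω} : τ ∈ S → InGen S τ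
  | comp {τ μ : Ω → Ω} : InGen S τ → InGen S μ → InGen S (τ ∘ μ)

/-- The semigroup generated (under composition) by a set of transformations. -/
def gen {Ω : Type} (S : Set (Ω → Ω)) : Set (Ω → Ω) := {τ | InGen S τ}

/-- A family of transformations of a space `Ω` has the ID ("Infinite is Dense") property
if every closed invariant proper subset of `Ω` is finite. -/
def HasID {Ω : Type} [TopologicalSpace Ω] (S : Set (Ω → Ω)) : Prop :=
  ∀ A : Set Ω, IsClosed A → (∀ τ ∈ S, ∀ x ∈ A, τ x ∈ A) → A ≠ Set.univ → A.Finite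

/-- The restriction of a two-sided sequence to the coordinates `≥ -k`, as a one-sided sequence. -/
def restrictFrom (A : Type) (k : ℕ) (x : ℤ → A) : ℕ → A := fun n => x (n - k)

theorem continuous_restrictFrom (A : Type) [TopologicalSpace A] (k : ℕ) :
    Continuous (restrictFrom A k) :=
  continuous_pi fun _ => continuous_apply _

/-- A shift-commuting map is determined by its zeroth output coordinate. -/
theorem apply_eq_apply_shift_zero {A : Type} {τ : (ℕ → A) → (ℕ → A)}
    (h : τ ∘ shiftN A = shiftN A ∘ τ) (n : ℕ) (a : ℕ → A) :
    τ a n = τ (fun m => a (n + m)) 0 := by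
  induction n generalizing a with
  | zero => simp
  | succ n ih =>
    have h1 : τ a (n + 1) = τ (shiftN A a) n := (congrFun (congrFun h a) n).symm
    rw [h1, ih]
    simp only [shiftN, Nat.add_right_comm n _ 1]

theorem restrictFrom_extendZ {A : Type} {τ : (ℕ → A) → (ℕ → A)}
    (h : τ ∘ shiftN A = shiftN A ∘ τ) (k : ℕ) (x : ℤ → A) :
    restrictFrom A k (extendZ A τ x) = τ (restrictFrom A k x) := by
  funext n
  rw [apply_eq_apply_shift_zero h]
  simp only [restrictFrom, extendZ]
  congr 1
  funext m
  congr 1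
  push_cast
  ring

theorem restrictFrom_succ {A : Type} (k : ℕ) (x : ℤ → A) :
    restrictFrom A (k + 1) x = restrictFrom A k (invShiftZ A x) := by
  funext n
  simp only [restrictFrom, invShiftZ]
  congr 1
  push_cast
  ring

theorem image_restrictFrom_antitone {A : Type} {X : Set (ℤ → A)}
    (hX : ∀ x ∈ X, invShiftZ A x ∈ X) : Antitone fun k => restrictFrom A k '' X := by
  refine antitone_nat_of_succ_le fun k => ?_
  rintro _ ⟨x, hx, rfl⟩
  exact ⟨_, hX x hx, (restrictFrom_succ k x).symm⟩

theorem restrictFrom_apply_toNat {A : Type} {k : ℕ} {i : ℤ} (hi : -i ≤ k) (x : ℤ → A) :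
    restrictFrom A k x (i + k).toNat = x i := by
  simp only [restrictFrom]
  congr 1
  omega

/-- Distinct two-sided sequences are eventually distinguished by their restrictions. -/
theorem eventually_restrictFrom_injOn {A : Type} (F : Finset (ℤ → A)) :
    ∀ᶠ k in Filter.atTop, Set.InjOn (restrictFrom A k) F := by
  have h : ∀ᶠ k in Filter.atTop, ∀ x ∈ F, ∀ y ∈ F,
      restrictFrom A k x = restrictFrom A k y → x = y := by
    refine (Filter.eventually_all_finset F).2 fun x _ =>
      (Filter.eventually_all_finset F).2 fun y _ => ?_
    by_cases hxy : x = y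
    · exact Filter.Eventually.of_forall fun _ _ => hxy
    obtain ⟨i, hi⟩ := Function.ne_iff.1 hxy
    filter_upwards [Filter.eventually_ge_atTop (-i).toNat] with k hk hres
    have hik : -i ≤ k := by omega
    rw [← restrictFrom_apply_toNat hik x, ← restrictFrom_apply_toNat hik y, hres] at hi
    exact absurd rfl hi
  filter_upwards [h] with k hk x hx y hy hxy using hk x hx y hy hxy

/-- A set of two-sided sequences stable under the inverse shift is finite as soon as one of its
one-sided restrictions is. -/
theorem finite_of_finite_image_restrictFrom {A : Type} {X : Set (ℤ → A)}
    (hX : ∀ x ∈ X, invShiftZ A x ∈ X) {k : ℕ} (hk : (restrictFrom A k '' X).Finite) :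
    X.Finite := by
  by_contra hinf
  obtain ⟨F, hFX, hF⟩ := Set.Infinite.exists_subset_card_eq hinf (hk.toFinset.card + 1)
  obtain ⟨j, hinj, hkj⟩ :=
    ((eventually_restrictFrom_injOn F).and (Filter.eventually_ge_atTop k)).exists
  have hle : F.card ≤ hk.toFinset.card :=
    Finset.card_le_card_of_injOn (restrictFrom A j)
      (fun x hx => hk.mem_toFinset.2
        (image_restrictFrom_antitone hX hkj ⟨x, hFX hx, rfl⟩)) hinj
  omega

/-- A closed set of two-sided sequences whose one-sided restrictions are all full is full. -/
theorem eq_univ_of_image_restrictFrom_eq_univ {A : Type} [TopologicalSpace A] {X : Set (ℤ → A)}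
    (hX : IsClosed X) (h : ∀ k, restrictFrom A k '' X = Set.univ) : X = Set.univ := by
  refine Set.eq_univ_of_forall fun x => ?_
  have hex : ∀ k, ∃ y ∈ X, restrictFrom A k y = restrictFrom A k x := fun k => by
    have hmem : restrictFrom A k x ∈ restrictFrom A k '' X := by
      rw [h k]
      exact Set.mem_univ _
    exact hmem
  choose y hyX hy using hex
  refine hX.mem_of_tendsto (f := y) (b := Filter.atTop) (tendsto_pi_nhds.2 fun i => ?_)
    (Filter.Eventually.of_forall hyX)
  refine tendsto_const_nhds.congr' ?_
  filter_upwards [Filter.eventually_ge_atTop (-i).toNat] with k hk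
  have hik : -i ≤ k := by omega
  rw [← restrictFrom_apply_toNat hik x, ← restrictFrom_apply_toNat hik (y k), hy k]

/-- If `Σ ⊆ CAT(Λ_s^ℕ)` is an ID semigroup, then the semigroup
`⟨Σ, σ⁻¹⟩ ⊆ CAT(Λ_s^ℤ)` generated by `Σ` (regarded inside `CAT(Λ_s^ℤ)`) together with
the inverse shift is an ID semigroup on `Λ_s^ℤ`. -/
theorem oneSided_ID_to_twoSided_ID (s : ℕ) (hs : 2 ≤ s)
    (S : Set ((ℕ → Fin s) → (ℕ → Fin s))) (hsub : S ⊆ CATset (Fin s))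
    (hcomp : ∀ τ ∈ S, ∀ μ ∈ S, τ ∘ μ ∈ S) (hID : HasID S) :
    HasID (gen ((extendZ (Fin s) '' S) ∪ {invShiftZ (Fin s)})) := by
  intro X hX hinv hne
  have hshift : ∀ x ∈ X, invShiftZ (Fin s) x ∈ X := hinv _ (InGen.base (Or.inr rfl))
  obtain ⟨k, hk⟩ : ∃ k, restrictFrom (Fin s) k '' X ≠ Set.univ := by
    by_contra! h
    exact hne (eq_univ_of_image_restrictFrom_eq_univ hX h)
  refine finite_of_finite_image_restrictFrom hshift (k := k) (hID _ ?_ ?_ hk)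
  · exact (hX.isCompact.image (continuous_restrictFrom _ k)).isClosed
  · rintro τ hτ _ ⟨x, hx, rfl⟩
    exact ⟨extendZ (Fin s) τ x, hinv _ (InGen.base (Or.inl ⟨τ, hτ, rfl⟩)) x hx,
      restrictFrom_extendZ (hsub hτ).2 k x⟩
end

section
/- Let Σ ⊆ CAT(Λ_s^ℕ) be a maximal commutative semigroup. Then ⟨Σ, σ^{−1}⟩, the semigroup generated by Σ (regarded inside CAT(Λ_s^ℤ)) together with the inverse shift σ^{−1}, is maximal commutative in CAT(Λ_s^ℤ). -/
/-- A cellular automaton transformation of the two-sided full shift over `A`. -/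
def IsCATZ (A : Type) [TopologicalSpace A] (τ : (ℤ → A) → (ℤ → A)) : Prop :=
  Continuous τ ∧ τ ∘ shiftZ A = shiftZ A ∘ τ

/-- The semigroup `CAT(Λ^ℤ)` of all two-sided cellular automaton transformations. -/
def CATZset (A : Type) [TopologicalSpace A] : Set ((ℤ → A) → (ℤ → A)) := {τ | IsCATZ A τ}

/-- `S` is a maximal commutative subsemigroup of `CAT`. -/
def IsMC {Ω : Type} (CAT S : Set (Ω → Ω)) : Prop :=
  S ⊆ CAT ∧ (∀ τ ∈ S, ∀ μ ∈ S, τ ∘ μ = μ ∘ τ) ∧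
    ∀ μ ∈ CAT, (∀ τ ∈ S, μ ∘ τ = τ ∘ μ) → μ ∈ S

/-- A continuous map from the two-sided full shift to a discrete space ignores all coordinates
sufficiently far to the left. -/
lemma exists_left_bound_of_continuous {A B : Type} [TopologicalSpace A] [DiscreteTopology A]
    [CompactSpace A] [TopologicalSpace B] [DiscreteTopology B] {f : (ℤ → A) → B}
    (hf : Continuous f) :
    ∃ r : ℕ, ∀ x y : ℤ → A, (∀ z : ℤ, -(r : ℤ) ≤ z → x z = y z) → f x = f y := by
  suffices h : ∃ r : ℕ, ∀ x ∈ (Set.univ : Set (ℤ → A)), ∀ y : ℤ → A,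
      (∀ z : ℤ, -(r : ℤ) ≤ z → x z = y z) → f x = f y by
    obtain ⟨r, hr⟩ := h
    exact ⟨r, fun x => hr x trivial⟩
  refine isCompact_univ.induction_on
    (p := fun s => ∃ r : ℕ, ∀ x ∈ s, ∀ y : ℤ → A,
      (∀ z : ℤ, -(r : ℤ) ≤ z → x z = y z) → f x = f y) ?_ ?_ ?_ ?_
  · exact ⟨0, fun x hx => hx.elim⟩
  · rintro s t hst ⟨r, hr⟩
    exact ⟨r, fun x hx => hr x (hst hx)⟩
  · rintro s t ⟨r, hr⟩ ⟨q, hq⟩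
    refine ⟨max r q, ?_⟩
    rintro x (hx | hx) y hxy
    · exact hr x hx y fun z hz => hxy z (by push_cast; omega)
    · exact hq x hx y fun z hz => hxy z (by push_cast; omega)
  · intro a _
    have hopen : IsOpen (f ⁻¹' {f a}) := (isOpen_discrete _).preimage hf
    obtain ⟨I, u, hu, hIu⟩ := isOpen_pi_iff.1 hopen a rfl
    have hcyl : (I : Set ℤ).pi u ∈ nhds a :=
      (isOpen_set_pi I.finite_toSet fun i hi => (hu i hi).1).mem_nhds fun i hi => (hu i hi).2
    refine ⟨_, mem_nhdsWithin_of_mem_nhds hcyl, I.sup Int.natAbs, fun x hx y hxy => ?_⟩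
    have hy : y ∈ (I : Set ℤ).pi u := by
      intro i hi
      have hle : i.natAbs ≤ I.sup Int.natAbs := Finset.le_sup (f := Int.natAbs) hi
      rw [← hxy i (by omega)]
      exact hx i hi
    exact (hIu hx : f x = f a).trans (hIu hy : f y = f a).symm

lemma IsCAT.comp {A : Type} [TopologicalSpace A] {τ μ : (ℕ → A) → (ℕ → A)}
    (hτ : IsCAT A τ) (hμ : IsCAT A μ) : IsCAT A (τ ∘ μ) :=
  ⟨hτ.1.comp hμ.1, by
    rw [Function.comp_assoc, hμ.2, ← Function.comp_assoc, hτ.2, Function.comp_assoc]⟩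

lemma IsCATZ.comp {A : Type} [TopologicalSpace A] {τ μ : (ℤ → A) → (ℤ → A)}
    (hτ : IsCATZ A τ) (hμ : IsCATZ A μ) : IsCATZ A (τ ∘ μ) :=
  ⟨hτ.1.comp hμ.1, by
    rw [Function.comp_assoc, hμ.2, ← Function.comp_assoc, hτ.2, Function.comp_assoc]⟩

lemma IsCAT.apply_eq {A : Type} [TopologicalSpace A] {τ : (ℕ → A) → (ℕ → A)}
    (hτ : IsCAT A τ) (b : ℕ → A) (n : ℕ) : τ b n = τ (fun m => b (n + m)) 0 := by
  induction n generalizing b with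
  | zero => simp
  | succ n ih =>
    have h : τ b (n + 1) = τ (shiftN A b) n := (congrFun (congrFun hτ.2 b) n).symm
    rw [h, ih]
    congr 1
    funext m
    simp only [shiftN]
    congr 1
    omega

lemma IsCATZ.apply_add_nat {A : Type} [TopologicalSpace A] {μ : (ℤ → A) → (ℤ → A)}
    (hμ : IsCATZ A μ) (a : ℤ → A) (k : ℤ) (n : ℕ) :
    μ (fun z => a (z + n)) k = μ a (k + n) := by
  induction n generalizing k with
  | zero => simp
  | succ n ih =>
    have h : μ (fun z => a (z + 1 + n)) k = μ (fun z => a (z + n)) (k + 1) :=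
      congrFun (congrFun hμ.2 (fun z => a (z + n))) k
    rw [ih] at h
    simpa only [Nat.cast_succ, add_assoc, add_comm (1 : ℤ)] using h

lemma IsCATZ.apply_add {A : Type} [TopologicalSpace A] {μ : (ℤ → A) → (ℤ → A)}
    (hμ : IsCATZ A μ) (a : ℤ → A) (k m : ℤ) :
    μ (fun z => a (z + m)) k = μ a (k + m) := by
  obtain ⟨n, rfl | rfl⟩ := m.eq_nat_or_neg
  · exact hμ.apply_add_nat a k n
  · have h := hμ.apply_add_nat (fun z => a (z + -n)) (k + -n) n
    simpa using h.symm

lemma isCATZ_extendZ {A : Type} [TopologicalSpace A] {τ : (ℕ → A) → (ℕ → A)}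
    (hτ : IsCAT A τ) : IsCATZ A (extendZ A τ) := by
  refine ⟨continuous_pi fun k => (continuous_apply 0).comp (hτ.1.comp ?_), ?_⟩
  · exact continuous_pi fun n => continuous_apply _
  · funext a k
    simp [extendZ, shiftZ, add_right_comm]

lemma extendZ_comp {A : Type} [TopologicalSpace A] {τ μ : (ℕ → A) → (ℕ → A)}
    (hμ : IsCAT A μ) : extendZ A (τ ∘ μ) = extendZ A τ ∘ extendZ A μ := by
  funext a k
  simp only [extendZ, Function.comp_apply]
  congr 1
  funext n
  rw [hμ.apply_eq]
  simp [add_assoc]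

lemma extendZ_inj {A : Type} [TopologicalSpace A] {τ μ : (ℕ → A) → (ℕ → A)}
    (hτ : IsCAT A τ) (hμ : IsCAT A μ) (h : extendZ A τ = extendZ A μ) : τ = μ := by
  funext b n
  rw [hτ.apply_eq, hμ.apply_eq]
  have h' := congrFun (congrFun h fun z => b z.toNat) n
  simpa only [extendZ, ← Nat.cast_add, Int.toNat_natCast] using h'

lemma isCATZ_invShiftZ (A : Type) [TopologicalSpace A] : IsCATZ A (invShiftZ A) :=
  ⟨continuous_pi fun k => continuous_apply (k - 1), by
    funext a k
    simp [invShiftZ, shiftZ]⟩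

lemma IsCATZ.comp_invShiftZ {A : Type} [TopologicalSpace A] {μ : (ℤ → A) → (ℤ → A)}
    (hμ : IsCATZ A μ) : μ ∘ invShiftZ A = invShiftZ A ∘ μ := by
  funext a k
  exact hμ.apply_add a k (-1)

/-- A map commuting with all generators commutes with the generated semigroup. -/
lemma InGen.commute {Ω : Type} {T : Set (Ω → Ω)} {μ τ : Ω → Ω}
    (hμ : ∀ ρ ∈ T, μ ∘ ρ = ρ ∘ μ) (hτ : InGen T τ) : μ ∘ τ = τ ∘ μ := by
  induction hτ with
  | base h => exact hμ _ h
  | comp _ _ ih₁ ih₂ =>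
    rw [← Function.comp_assoc, ih₁, Function.comp_assoc, ih₂, Function.comp_assoc]

/-- Every two-sided cellular automaton becomes one-sided after composing with a power of the
shift. -/
lemma exists_extendZ_eq_shift {A : Type} [TopologicalSpace A] [DiscreteTopology A]
    [CompactSpace A] {μ : (ℤ → A) → (ℤ → A)} (hμ : IsCATZ A μ) :
    ∃ (r : ℕ) (τ : (ℕ → A) → (ℕ → A)), IsCAT A τ ∧
      ∀ a k, extendZ A τ a k = μ a (k + r) := by
  obtain ⟨r, hr⟩ := exists_left_bound_of_continuous ((continuous_apply (0 : ℤ)).comp hμ.1)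
  simp only [Function.comp_apply] at hr
  refine ⟨r, fun b k => μ (fun z => b (z + k + r).toNat) 0, ⟨?_, ?_⟩, ?_⟩
  · refine continuous_pi fun k => (continuous_apply (0 : ℤ)).comp (hμ.1.comp ?_)
    exact continuous_pi fun z => continuous_apply _
  · funext b k
    refine hr _ _ fun z hz => ?_
    simp only [shiftN]
    congr 1
    push_cast
    omega
  · intro a k
    have h := hμ.apply_add a 0 (k + r)
    rw [zero_add] at h
    rw [← h]
    refine hr _ _ fun z hz => ?_
    simp only
    congr 1
    push_cast
    omega

lemma invShiftZ_iterate_apply {A : Type} (a : ℤ → A) (n : ℕ) (k : ℤ) :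
    (invShiftZ A)^[n] a k = a (k - n) := by
  induction n generalizing k with
  | zero => simp
  | succ n ih =>
    rw [Function.iterate_succ_apply', invShiftZ, ih]
    congr 1
    push_cast
    ring

lemma InGen.iterate_comp {Ω : Type} {T : Set (Ω → Ω)} {ρ τ : Ω → Ω}
    (hρ : InGen T ρ) (hτ : InGen T τ) (n : ℕ) : InGen T (ρ^[n] ∘ τ) := by
  induction n with
  | zero => exact hτ
  | succ n ih =>
    rw [Function.iterate_succ', Function.comp_assoc]
    exact hρ.comp ih

/-- If `Σ ⊆ CAT(Λ_s^ℕ)` is maximal commutative, then `⟨Σ, σ⁻¹⟩`, the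
semigroup generated by `Σ` (regarded inside `CAT(Λ_s^ℤ)`) and the inverse shift, is
maximal commutative in `CAT(Λ_s^ℤ)`. -/
theorem oneSided_MC_to_twoSided_MC (s : ℕ) (hs : 2 ≤ s)
    (S : Set ((ℕ → Fin s) → (ℕ → Fin s))) (hMC : IsMC (CATset (Fin s)) S) :
    IsMC (CATZset (Fin s)) (gen ((extendZ (Fin s) '' S) ∪ {invShiftZ (Fin s)})) := by
  obtain ⟨hsub, hcomm, hmax⟩ := hMC
  have hgenCAT : ∀ τ ∈ extendZ (Fin s) '' S ∪ {invShiftZ (Fin s)}, IsCATZ (Fin s) τ := by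
    rintro _ (⟨τ, hτ, rfl⟩ | rfl)
    · exact isCATZ_extendZ (hsub hτ)
    · exact isCATZ_invShiftZ _
  have hgenComm : ∀ τ ∈ extendZ (Fin s) '' S ∪ {invShiftZ (Fin s)},
      ∀ μ ∈ extendZ (Fin s) '' S ∪ {invShiftZ (Fin s)}, τ ∘ μ = μ ∘ τ := by
    rintro _ (⟨τ, hτ, rfl⟩ | rfl) _ (⟨μ, hμ, rfl⟩ | rfl)
    · rw [← extendZ_comp (hsub hμ), ← extendZ_comp (hsub hτ), hcomm τ hτ μ hμ]
    · exact (isCATZ_extendZ (hsub hτ)).comp_invShiftZ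
    · exact (isCATZ_extendZ (hsub hμ)).comp_invShiftZ.symm
    · rfl
  refine ⟨fun τ hτ => ?_, fun τ hτ μ hμ => ?_, fun μ hμ hμcomm => ?_⟩
  · induction hτ with
    | base h => exact hgenCAT _ h
    | comp _ _ ih₁ ih₂ => exact IsCATZ.comp ih₁ ih₂
  · exact InGen.commute (fun ρ hρ => (InGen.commute (hgenComm ρ hρ) hτ).symm) hμ
  · obtain ⟨r, τ, hτ, hτμ⟩ := exists_extendZ_eq_shift hμ
    have hτS : τ ∈ S := by
      refine hmax τ hτ fun ρ hρ => ?_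
      have hρCAT : IsCAT (Fin s) ρ := hsub hρ
      refine extendZ_inj (hτ.comp hρCAT) (hρCAT.comp hτ) ?_
      rw [extendZ_comp hρCAT, extendZ_comp hτ]
      funext a k
      have hμρ := hμcomm _ (InGen.base (Or.inl ⟨ρ, hρ, rfl⟩))
      have hshift : extendZ (Fin s) τ a = fun z => μ a (z + r) := funext (hτμ a)
      rw [Function.comp_apply, Function.comp_apply, hτμ, hshift,
        (isCATZ_extendZ hρCAT).apply_add]
      exact congrFun (congrFun hμρ a) _
    have hμeq : μ = (invShiftZ (Fin s))^[r] ∘ extendZ (Fin s) τ := by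
      funext a k
      rw [Function.comp_apply, invShiftZ_iterate_apply, hτμ, sub_add_cancel]
    rw [hμeq]
    exact InGen.iterate_comp (.base (Or.inr rfl)) (.base (Or.inl ⟨τ, hτS, rfl⟩)) r
end

section
/- Let Σ ⊆ CAT(Λ_s^ℤ) be an ID semigroup. Then ⟨Σ, σ⟩₊ = ⟨Σ, σ⟩ ∩ CAT(Λ_s^ℕ), the sub-semigroup of one-sided transformations in the semigroup generated by Σ and the shift σ, is an ID semigroup of CAT(Λ_s^ℕ). -/
/-- The right tail of a two-sided sequence, starting at position `k`. -/
def tailFrom {A : Type} (k : ℤ) (x : ℤ → A) : ℕ → A := fun n => x (k + n)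

/-- The two-sided sequence whose coordinates from `-n` on are those of `a`, with the value `a 0`
further to the left. -/
def padLeft {A : Type} (n : ℕ) (a : ℕ → A) : ℤ → A := fun j => a (j + n).toNat

theorem continuous_tailFrom {A : Type} [TopologicalSpace A] (k : ℤ) :
    Continuous (tailFrom (A := A) k) :=
  continuous_pi fun _ => continuous_apply _

theorem continuous_padLeft {A : Type} [TopologicalSpace A] (n : ℕ) :
    Continuous (padLeft (A := A) n) :=
  continuous_pi fun _ => continuous_apply _

theorem tailFrom_padLeft {A : Type} (n N : ℕ) (h : N ≤ n) (a : ℕ → A) :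
    tailFrom (-(N : ℤ)) (padLeft n a) = fun i => a (n - N + i) := by
  funext i
  simp only [tailFrom, padLeft]
  congr 1
  omega

theorem shift_iterate_mem {A : Type} {X : Set (ℕ → A)} (hX : ∀ a ∈ X, shiftN A a ∈ X) (n : ℕ)
    {a : ℕ → A} (ha : a ∈ X) : (fun i => a (n + i)) ∈ X := by
  induction n with
  | zero => simpa using ha
  | succ n ih =>
    convert hX _ ih using 1
    funext i
    simp only [shiftN]
    congr 1
    omega

/-- The two-sided sequences all of whose right tails lie in `X`. -/
def naturalExtension {A : Type} (X : Set (ℕ → A)) : Set (ℤ → A) := {x | ∀ k, tailFrom k x ∈ X}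

theorem isClosed_naturalExtension {A : Type} [TopologicalSpace A] {X : Set (ℕ → A)}
    (hX : IsClosed X) : IsClosed (naturalExtension X) := by
  simp only [naturalExtension, Set.ofPred_forall]
  exact isClosed_iInter fun k => hX.preimage (continuous_tailFrom k)

/-- A two-sided cellular automaton transformation commutes with all integer translations. -/
theorem IsCATZ.apply_translate {A : Type} [TopologicalSpace A] {τ : (ℤ → A) → (ℤ → A)}
    (h : IsCATZ A τ) (k : ℤ) (x : ℤ → A) :
    τ (fun j => x (k + j)) = fun j => τ x (k + j) := by
  have hone : ∀ y, τ (fun j => y (j + 1)) = fun j => τ y (j + 1) := fun y => congrFun h.2 y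
  induction k with
  | zero => simp
  | succ k ih =>
    have e : ∀ j : ℤ, (k : ℤ) + 1 + j = k + (j + 1) := fun j => by ring
    have := hone (fun j => x (k + j))
    rw [ih] at this
    simpa only [e] using this
  | pred k ih =>
    have := hone (fun j => x (-(k : ℤ) - 1 + j))
    have e : (fun j : ℤ => x (-(k : ℤ) - 1 + (j + 1))) = fun j => x (-(k : ℤ) + j) := by
      funext j
      congr 1
      ring
    rw [e, ih] at this
    funext j
    have := congrFun this (j - 1)
    simp only [sub_add_cancel] at this
    rw [← this]
    congr 1
    ring

/-- A two-sided cellular automaton transformation has finite memory. -/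
theorem IsCATZ.exists_memory {A : Type} [TopologicalSpace A] [DiscreteTopology A] [Finite A]
    {τ : (ℤ → A) → (ℤ → A)} (h : IsCATZ A τ) :
    ∃ m : ℕ, ∀ (k : ℤ) (x y : ℤ → A), (∀ j, k - m ≤ j → x j = y j) → τ x k = τ y k := by
  suffices H : ∃ m : ℕ, ∀ x y : ℤ → A, (∀ j, -(m : ℤ) ≤ j → x j = y j) → τ x 0 = τ y 0 by
    obtain ⟨m, hm⟩ := H
    refine ⟨m, fun k x y hxy => ?_⟩
    have := hm (fun j => x (k + j)) (fun j => y (k + j)) fun j hj => hxy _ (by omega)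
    simpa [h.apply_translate] using this
  by_contra! hcon
  let K : ℕ → Set ((ℤ → A) × (ℤ → A)) :=
    fun m => {p | (∀ j, -(m : ℤ) ≤ j → p.1 j = p.2 j) ∧ τ p.1 0 ≠ τ p.2 0}
  have hclosed : ∀ m, IsClosed (K m) := by
    intro m
    refine IsClosed.inter ?_ ?_
    · change IsClosed {p : (ℤ → A) × (ℤ → A) | ∀ j, -(m : ℤ) ≤ j → p.1 j = p.2 j}
      simp only [Set.ofPred_forall]
      exact isClosed_iInter fun j => isClosed_iInter fun _ =>
        isClosed_eq (by fun_prop) (by fun_prop)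
    · have hc := h.1
      have : Continuous fun p : (ℤ → A) × (ℤ → A) => (τ p.1 0, τ p.2 0) := by fun_prop
      exact (isClosed_discrete {q : A × A | q.1 ≠ q.2}).preimage this
  obtain ⟨p, hp⟩ := IsCompact.nonempty_iInter_of_sequence_nonempty_isCompact_isClosed K
    (fun m p hp => ⟨fun j hj => hp.1 j (by push_cast; omega), hp.2⟩)
    (fun m => let ⟨x, y, hxy⟩ := hcon m; ⟨(x, y), hxy⟩) (hclosed 0).isCompact hclosed
  rw [Set.mem_iInter] at hp
  refine (hp 0).2 (congrArg (fun x => τ x 0) (funext fun j => (hp j.natAbs).1 j (by omega)))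

/-- After composition with a power of the shift, a two-sided cellular automaton transformation
becomes one-sided. -/
theorem IsCATZ.exists_oneSided {A : Type} [TopologicalSpace A] [DiscreteTopology A] [Finite A]
    {τ : (ℤ → A) → (ℤ → A)} (h : IsCATZ A τ) :
    ∃ (m : ℕ) (μ : (ℕ → A) → (ℕ → A)), IsCAT A μ ∧
      (∀ k x, μ (tailFrom k x) = tailFrom (k + m) (τ x)) ∧ extendZ A μ = (shiftZ A)^[m] ∘ τ := by
  obtain ⟨m, hm⟩ := h.exists_memory
  have hμ : ∀ k x, tailFrom m (τ (padLeft 0 (tailFrom k x))) = tailFrom (k + m) (τ x) := by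
    intro k x
    funext n
    have e := congrFun (h.apply_translate k x) (m + n)
    simp only [tailFrom]
    rw [add_assoc, ← e]
    refine hm _ _ _ fun j hj => ?_
    simp only [padLeft, tailFrom]
    congr 1
    omega
  refine ⟨m, fun a => tailFrom m (τ (padLeft 0 a)), ⟨?_, ?_⟩, hμ, ?_⟩
  · exact (continuous_tailFrom _).comp (h.1.comp (continuous_padLeft 0))
  · funext a
    have e : shiftN A a = tailFrom 1 (padLeft 0 a) := by
      funext n
      simp only [shiftN, padLeft, tailFrom]
      congr 1
      omega
    simp only [Function.comp_apply]
    rw [e, hμ]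
    funext n
    simp only [shiftN, tailFrom]
    congr 1
    push_cast
    ring
  · have hiter : ∀ (n : ℕ) (y : ℤ → A), (shiftZ A)^[n] y = fun j => y (j + n) := by
      intro n
      induction n with
      | zero => simp
      | succ n ih =>
        intro y
        rw [Function.iterate_succ_apply, ih]
        funext j
        simp only [shiftZ]
        congr 1
        push_cast
        ring
    funext x k
    rw [Function.comp_apply, hiter]
    change tailFrom m (τ (padLeft 0 (tailFrom k x))) 0 = _
    rw [hμ]
    simp [tailFrom]

theorem iterate_comp_mem_gen {Ω : Type} {S : Set (Ω → Ω)} {f g : Ω → Ω} (hf : f ∈ gen S)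
    (hg : g ∈ gen S) (n : ℕ) : f^[n] ∘ g ∈ gen S := by
  induction n with
  | zero => exact hg
  | succ n ih =>
    rw [Function.iterate_succ']
    exact InGen.comp (τ := f) (μ := f^[n] ∘ g) hf ih

/-- Long tails of points of a closed shift-invariant set `X` look locally like tails of points of
the natural extension of `X`. -/
theorem exists_prefix_eq_naturalExtension {A : Type} [TopologicalSpace A] [DiscreteTopology A]
    [Finite A] {X : Set (ℕ → A)} (hX : IsClosed X) (hshift : ∀ a ∈ X, shiftN A a ∈ X) (L : ℕ) :
    ∃ N : ℕ, ∀ a ∈ X, ∀ n, N ≤ n →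
      ∃ p ∈ tailFrom 0 '' naturalExtension X, ∀ i < L, a (n + i) = p i := by
  let r : (ℤ → A) → (Fin L → A) := fun x i => x (i : ℕ)
  have hr : Continuous r := continuous_pi fun _ => continuous_apply _
  let K : ℕ → Set (ℤ → A) := fun N => {x | tailFrom (-(N : ℤ)) x ∈ X} ∩
    r ⁻¹' (r '' naturalExtension X)ᶜ
  have hclosed : ∀ N, IsClosed (K N) := fun N =>
    (hX.preimage (continuous_tailFrom _)).inter ((isClosed_discrete _).preimage hr)
  have hK : ∃ N, K N = ∅ := by
    by_contra! hne
    obtain ⟨x, hx⟩ := IsCompact.nonempty_iInter_of_sequence_nonempty_isCompact_isClosed K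
      (fun N x hx => ⟨by
        change tailFrom (-(N : ℤ)) x ∈ X
        convert hshift _ hx.1 using 1
        funext i
        simp only [shiftN, tailFrom]
        congr 1
        push_cast
        ring, hx.2⟩) hne (hclosed 0).isCompact hclosed
    rw [Set.mem_iInter] at hx
    refine (hx 0).2 ⟨x, fun k => ?_, rfl⟩
    convert shift_iterate_mem hshift (k + k.natAbs).toNat (hx k.natAbs).1 using 1
    funext i
    simp only [tailFrom]
    congr 1
    omega
  obtain ⟨N, hN⟩ := hK
  refine ⟨N, fun a ha n hn => ?_⟩
  have hmem : padLeft n a ∉ K N := by simp [hN]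
  have htail : tailFrom (-(N : ℤ)) (padLeft n a) ∈ X := by
    rw [tailFrom_padLeft n N hn]
    exact shift_iterate_mem hshift _ ha
  have himage : r (padLeft n a) ∈ r '' naturalExtension X := by
    by_contra hc
    exact hmem ⟨htail, hc⟩
  obtain ⟨x, hx, hxr⟩ := himage
  refine ⟨_, ⟨x, hx, rfl⟩, fun i hi => ?_⟩
  have := congrFun hxr ⟨i, hi⟩
  simp only [r, padLeft] at this
  simp only [tailFrom, zero_add, this]
  congr 1
  omega

/-- A closed shift-invariant set with finite natural extension is finite. -/
theorem finite_of_finite_naturalExtension {A : Type} [TopologicalSpace A] [DiscreteTopology A]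
    [Finite A] {X : Set (ℕ → A)} (hX : IsClosed X) (hshift : ∀ a ∈ X, shiftN A a ∈ X)
    (hfin : (naturalExtension X).Finite) : X.Finite := by
  set P : Set (ℕ → A) := tailFrom 0 '' naturalExtension X
  have hPfin : P.Finite := hfin.image _
  have hPshift : ∀ p ∈ P, shiftN A p ∈ P := by
    rintro _ ⟨x, hx, rfl⟩
    refine ⟨fun j => x (1 + j), fun k => ?_, ?_⟩
    · convert hx (1 + k) using 1
      funext i
      simp only [tailFrom, add_assoc]
    · funext i
      simp only [tailFrom, shiftN]
      congr 1
      push_cast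
      ring
  have hsep : ∃ L : ℕ, ∀ p ∈ P, ∀ q ∈ P, (∀ i < L, p i = q i) → p = q := by
    have : ∀ᶠ L : ℕ in Filter.atTop, ∀ z ∈ P ×ˢ P, (∀ i < L, z.1 i = z.2 i) → z.1 = z.2 := by
      rw [Filter.eventually_all_finite (hPfin.prod hPfin)]
      intro z _
      by_cases hz : z.1 = z.2
      · simp [hz]
      · obtain ⟨i, hi⟩ := Function.ne_iff.mp hz
        filter_upwards [Filter.eventually_gt_atTop i] with L hL h
        exact absurd (h i hL) hi
    obtain ⟨L, hL⟩ := this.exists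
    exact ⟨L, fun p hp q hq => hL (p, q) ⟨hp, hq⟩⟩
  obtain ⟨L, hL⟩ := hsep
  obtain ⟨N, hN⟩ := exists_prefix_eq_naturalExtension hX hshift (L + 1)
  have htail : ∀ a ∈ X, (fun i => a (N + i)) ∈ P := by
    intro a ha
    have : Nonempty (ℕ → A) := ⟨a⟩
    choose! p hp hpa using hN a ha
    have hstep : ∀ n, N ≤ n → shiftN A (p n) = p (n + 1) := by
      intro n hn
      refine hL _ (hPshift _ (hp n hn)) _ (hp (n + 1) (by omega)) fun i hi => ?_
      rw [← hpa (n + 1) (by omega) i (by omega)]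
      simp only [shiftN]
      rw [← hpa n hn (i + 1) (by omega)]
      congr 1
      omega
    have hall : ∀ j n, N ≤ n → p n j = a (n + j) := by
      intro j
      induction j with
      | zero => exact fun n hn => (hpa n hn 0 (by omega)).symm
      | succ j ih =>
        intro n hn
        have := congrFun (hstep n hn) j
        simp only [shiftN] at this
        rw [this, ih (n + 1) (by omega)]
        congr 1
        omega
    convert hp N le_rfl using 1
    exact funext fun j => (hall j N le_rfl).symm
  refine Set.Finite.of_injOn (f := fun a : ℕ → A => ((fun i : Fin N => a i), fun i => a (N + i)))
    (t := Set.univ ×ˢ P) (fun a ha => ⟨trivial, htail a ha⟩) ?_ (Set.finite_univ.prod hPfin)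
  intro a _ b _ hab
  obtain ⟨hhead, htl⟩ := Prod.mk.inj hab
  funext n
  rcases lt_or_ge n N with hn | hn
  · exact congrFun hhead ⟨n, hn⟩
  · simpa [Nat.add_sub_cancel' hn] using congrFun htl (n - N)

/-- If `Σ ⊆ CAT(Λ_s^ℤ)` is an ID semigroup, then
`⟨Σ, σ⟩₊ = ⟨Σ, σ⟩ ∩ CAT(Λ_s^ℕ)`, the sub-semigroup of one-sided transformations in the
semigroup generated by `Σ` and the shift, is an ID semigroup of `CAT(Λ_s^ℕ)`. -/
theorem twoSided_ID_to_oneSided_ID (s : ℕ) (hs : 2 ≤ s)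
    (S : Set ((ℤ → Fin s) → (ℤ → Fin s))) (hsub : S ⊆ CATZset (Fin s))
    (hcomp : ∀ τ ∈ S, ∀ μ ∈ S, τ ∘ μ ∈ S) (hID : HasID S) :
    HasID {τ : (ℕ → Fin s) → (ℕ → Fin s) |
      IsCAT (Fin s) τ ∧ extendZ (Fin s) τ ∈ gen (S ∪ {shiftZ (Fin s)})} := by
  intro X hX hinv hne
  have hshift : ∀ a ∈ X, shiftN (Fin s) a ∈ X := by
    refine hinv _ ⟨⟨continuous_pi fun _ => continuous_apply _, rfl⟩, ?_⟩
    have e : extendZ (Fin s) (shiftN (Fin s)) = shiftZ (Fin s) := by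
      funext x k
      simp [extendZ, shiftN, shiftZ]
    rw [e]
    exact InGen.base (Or.inr rfl)
  refine finite_of_finite_naturalExtension hX hshift
    (hID _ (isClosed_naturalExtension hX) ?_ ?_)
  · intro τ hτ x hx k
    obtain ⟨m, μ, hμ, htail, hext⟩ := (hsub hτ).exists_oneSided
    have hgen : extendZ (Fin s) μ ∈ gen (S ∪ {shiftZ (Fin s)}) := by
      rw [hext]
      exact iterate_comp_mem_gen (InGen.base (Or.inr rfl)) (InGen.base (Or.inl hτ)) m
    simpa [htail] using hinv μ ⟨hμ, hgen⟩ _ (hx (k - m))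
  · intro huniv
    refine hne (Set.eq_univ_of_forall fun a => ?_)
    have ha : padLeft 0 a ∈ naturalExtension X := huniv ▸ Set.mem_univ _
    have h0 := ha 0
    have e : tailFrom 0 (padLeft 0 a) = a := by simpa using tailFrom_padLeft 0 0 le_rfl a
    rwa [e] at h0
end

section
/- Let s = 2 and let τ ∈ CAT(Λ_2^ℤ) be defined by τ(a)_k = a_k + a_{k+1}·a_{k+2} (arithmetic mod 2). Let e^i ∈ Λ_2^ℤ be the sequence with 1 in coordinate i and 0 elsewhere, and let A = {e^i : i ∈ ℤ} ∪ {0}, where 0 is the all-zero sequence. Then A is an infinite closed proper subset of Λ_2^ℤ invariant under the semigroup ⟨τ, σ⟩; in particular ⟨τ, σ⟩ is not an ID semigroup. -/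
/-- The transformation `τ(a)_k = a_k + a_{k+1}·a_{k+2}` over `Λ_2 = ℤ/2ℤ`. -/
def tau2 : (ℤ → ZMod 2) → (ℤ → ZMod 2) := fun a k => a k + a (k + 1) * a (k + 2)

/-- The sequence `e^i` with `1` in coordinate `i` and `0` elsewhere. -/
def eSeq (i : ℤ) : ℤ → ZMod 2 := fun k => if k = i then 1 else 0

/-- The set `A = {e^i : i ∈ ℤ} ∪ {0}`. -/
def Aset : Set (ℤ → ZMod 2) := {x | (∃ i : ℤ, x = eSeq i) ∨ x = fun _ => 0}

theorem eSeq_injective : Function.Injective eSeq := fun i j h => by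
  have hval := congrFun h i
  by_contra hij
  simp [eSeq, hij] at hval

/-- `Aset` consists of the sequences with at most one nonzero coordinate. -/
theorem mem_Aset_iff {x : ℤ → ZMod 2} :
    x ∈ Aset ↔ ∀ i j : ℤ, i ≠ j → x i * x j = 0 := by
  constructor
  · rintro (⟨n, rfl⟩ | rfl) i j hij
    · by_cases hi : i = n
      · have hj : j ≠ n := fun hj => hij (hi.trans hj.symm)
        simp [eSeq, hj]
      · simp [eSeq, hi]
    · simp
  · intro h
    by_cases hx : ∃ i, x i ≠ 0
    · obtain ⟨i, hi⟩ := hx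
      refine Or.inl ⟨i, funext fun k => ?_⟩
      by_cases hk : k = i
      · subst hk
        exact (Fin.eq_one_of_ne_zero (x k) hi).trans (if_pos rfl).symm
      · simpa [eSeq, hk, hi] using h k i hk
    · push Not at hx
      exact Or.inr (funext hx)

theorem infinite_Aset : Aset.Infinite :=
  (Set.infinite_range_of_injective eSeq_injective).mono <| by
    rintro _ ⟨i, rfl⟩
    exact Or.inl ⟨i, rfl⟩

theorem isClosed_Aset : IsClosed Aset := by
  have h : Aset = ⋂ (i : ℤ) (j : ℤ) (_ : i ≠ j), {x : ℤ → ZMod 2 | x i * x j = 0} := by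
    ext x
    simp [mem_Aset_iff]
  have : ContinuousMul (ZMod 2) := ⟨continuous_of_discreteTopology⟩
  rw [h]
  exact isClosed_iInter fun i => isClosed_iInter fun j => isClosed_iInter fun _ =>
    isClosed_eq (by fun_prop) continuous_const

theorem Aset_ne_univ : Aset ≠ Set.univ := fun h => by
  have h1 : (fun _ => 1 : ℤ → ZMod 2) ∈ Aset := h ▸ Set.mem_univ _
  simpa using mem_Aset_iff.1 h1 0 1 (by simp)

/-- `tau2` fixes every point of `Aset`. -/
theorem tau2_eq_self {x : ℤ → ZMod 2} (hx : x ∈ Aset) : tau2 x = x := by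
  funext k
  simp [tau2, mem_Aset_iff.1 hx (k + 1) (k + 2) (by simp)]

theorem shiftZ_mem_Aset {x : ℤ → ZMod 2} (hx : x ∈ Aset) : shiftZ (ZMod 2) x ∈ Aset :=
  mem_Aset_iff.2 fun i j hij => mem_Aset_iff.1 hx (i + 1) (j + 1) (by simpa using hij)

/-- A set invariant under the generators is invariant under the generated semigroup. -/
theorem gen_invariant {Ω : Type} {S : Set (Ω → Ω)} {A : Set Ω}
    (h : ∀ τ ∈ S, ∀ x ∈ A, τ x ∈ A) : ∀ τ ∈ gen S, ∀ x ∈ A, τ x ∈ A := by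
  intro τ hτ
  induction hτ with
  | base hS => exact h _ hS
  | comp _ _ ih₁ ih₂ => exact fun x hx => ih₁ _ (ih₂ x hx)

theorem gen_tau2_shiftZ_invariant :
    ∀ τ ∈ gen ({tau2, shiftZ (ZMod 2)} : Set ((ℤ → ZMod 2) → (ℤ → ZMod 2))),
      ∀ x ∈ Aset, τ x ∈ Aset := by
  refine gen_invariant ?_
  rintro τ (rfl | rfl) x hx
  · rwa [tau2_eq_self hx]
  · exact shiftZ_mem_Aset hx

/-- `A = {e^i} ∪ {0}` is an infinite closed proper subset of `Λ_2^ℤ`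
invariant under the semigroup `⟨τ, σ⟩` where `τ(a)_k = a_k + a_{k+1}·a_{k+2}`; in
particular `⟨τ, σ⟩` is not an ID semigroup. -/
theorem tau2_shift_not_ID :
    Aset.Infinite ∧ IsClosed Aset ∧ Aset ≠ Set.univ ∧
      (∀ τ ∈ gen ({tau2, shiftZ (ZMod 2)} : Set ((ℤ → ZMod 2) → (ℤ → ZMod 2))),
        ∀ x ∈ Aset, τ x ∈ Aset) ∧
      ¬ HasID (gen ({tau2, shiftZ (ZMod 2)} : Set ((ℤ → ZMod 2) → (ℤ → ZMod 2)))) := by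
  exact ⟨infinite_Aset, isClosed_Aset, Aset_ne_univ, gen_tau2_shiftZ_invariant, fun h =>
    infinite_Aset (h Aset isClosed_Aset gen_tau2_shiftZ_invariant Aset_ne_univ)⟩
end
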